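/- Let x be an integral allocation and p a price vector with p_j > 0 for every good j, in a fair division instance with additive nonnegative valuations in which every agent positively values some good. Let 0 ≤ ε ≤ 1, and suppose that (1) x_i ⊆ MBB_i for every agent i and (2) x is ε-pEF1 with respect to p. Then NSW(x) ≥ e^{-(1+ε)/e} · NSW(x*), where x* is a Nash optimal allocation. -/

import Mathlib

open Finset

/-- The bundle of agent `k` under the integral allocation `a`. -/
def bundle {n m : ℕ} (a : Fin m → Fin n) (k : Fin n) : Finset (Fin m) :=
  Finset.univ.filter (fun j => a j = k)

/-- Spending of agent `k`: total price of its bundle. -/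
def spend {n m : ℕ} (p : Fin m → ℝ) (a : Fin m → Fin n) (k : Fin n) : ℝ :=
  ∑ j ∈ bundle a k, p j

/-- Nash social welfare of an integral allocation (real valuations). -/
noncomputable def NSW {n m : ℕ} (v : Fin n → Fin m → ℝ) (a : Fin m → Fin n) : ℝ :=
  (∏ i : Fin n, ∑ j ∈ bundle a i, v i j) ^ ((n : ℝ)⁻¹)

/-- A concave majorant of `Real.log` on the positive reals that agrees with it from `e` on and is
linear with slope `1 / e` before; unlike `Real.log` it is subadditive on `[0, ∞)`. -/
noncomputable def logMajorant (x : ℝ) : ℝ :=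
  if x ≤ Real.exp 1 then x / Real.exp 1 else Real.log x

theorem log_le_div_exp_one {x : ℝ} (hx : 0 < x) : Real.log x ≤ x / Real.exp 1 := by
  have h := Real.log_le_sub_one_of_pos (div_pos hx (Real.exp_pos 1))
  rw [Real.log_div hx.ne' (Real.exp_pos 1).ne', Real.log_exp] at h
  linarith

theorem logMajorant_le_div {x : ℝ} : logMajorant x ≤ x / Real.exp 1 := by
  unfold logMajorant
  split_ifs with h
  · exact le_rfl
  · exact log_le_div_exp_one ((Real.exp_pos 1).trans (not_le.mp h))

theorem le_exp_logMajorant {x : ℝ} (hx : 0 ≤ x) : x ≤ Real.exp (logMajorant x) := by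
  rcases hx.eq_or_lt with rfl | hx
  · positivity
  rw [← Real.log_le_iff_le_exp hx]
  unfold logMajorant
  split_ifs
  · exact log_le_div_exp_one hx
  · exact le_rfl

theorem logMajorant_add_le_of_exp_one_lt {x y : ℝ} (hx : Real.exp 1 < x) (hy : 0 ≤ y) :
    logMajorant (x + y) ≤ logMajorant x + logMajorant y := by
  have hE := Real.exp_pos 1
  have h2 : (2 : ℝ) < Real.exp 1 := lt_trans (by norm_num) Real.exp_one_gt_d9
  have hx0 : 0 < x := hE.trans hx
  rw [logMajorant, if_neg (by linarith), logMajorant, if_neg hx.not_ge, logMajorant]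
  split_ifs with h
  · have h3 := Real.log_le_sub_one_of_pos (show 0 < (x + y) / x by positivity)
    rw [Real.log_div (by positivity) hx0.ne', add_div, div_self hx0.ne'] at h3
    have h4 : y / x ≤ y / Real.exp 1 := div_le_div_of_nonneg_left hy hE hx.le
    linarith
  · have hy0 : Real.exp 1 < y := not_le.mp h
    rw [← Real.log_mul hx0.ne' (by linarith)]
    exact Real.log_le_log (by positivity) (by nlinarith)

theorem logMajorant_add_le {x y : ℝ} (hx : 0 ≤ x) (hy : 0 ≤ y) :
    logMajorant (x + y) ≤ logMajorant x + logMajorant y := by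
  rcases lt_or_ge (Real.exp 1) x with h | h
  · exact logMajorant_add_le_of_exp_one_lt h hy
  rcases lt_or_ge (Real.exp 1) y with h' | h'
  · rw [add_comm x, add_comm (logMajorant x)]
    exact logMajorant_add_le_of_exp_one_lt h' hx
  · refine logMajorant_le_div.trans ?_
    rw [logMajorant, if_pos h, logMajorant, if_pos h', add_div]

theorem logMajorant_sum_le {ι : Type*} (s : Finset ι) {q : ι → ℝ} (hq : ∀ j, 0 ≤ q j) :
    logMajorant (∑ j ∈ s, q j) ≤ ∑ j ∈ s, logMajorant (q j) := by
  classical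
  induction s using Finset.induction_on with
  | empty => simp [logMajorant, (Real.exp_pos 1).le]
  | insert j s hj ih =>
    rw [sum_insert hj, sum_insert hj]
    exact (logMajorant_add_le (hq j) (sum_nonneg fun j _ => hq j)).trans (by gcongr)

theorem sum_logMajorant_le_div {ι : Type*} (s : Finset ι) (q : ι → ℝ) :
    ∑ j ∈ s, logMajorant (q j) ≤ (∑ j ∈ s, q j) / Real.exp 1 := by
  rw [sum_div]
  exact sum_le_sum fun j _ => logMajorant_le_div

/-- A good of value `h` together with goods of total value `r ≤ β`. -/
theorem logMajorant_add_div_le {h r β : ℝ} (hr : 0 ≤ r) (hrβ : r ≤ β) (hβ : 1 ≤ β)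
    (hs : 1 ≤ h + r) :
    logMajorant h + r / Real.exp 1 ≤ Real.log (h + r) + β / Real.exp 1 := by
  have hE := Real.exp_pos 1
  unfold logMajorant
  split_ifs with hh
  · rw [← add_div, ← sub_le_iff_le_add, ← sub_div]
    rcases le_total (h + r) (Real.exp 1) with hse | hse
    · have h1 := Real.one_sub_inv_le_log_of_pos (show 0 < h + r by linarith)
      refine le_trans ?_ h1
      have h2 : (h + r - β) / Real.exp 1 ≤ (h + r - 1) / Real.exp 1 := by gcongr
      have h3 : (h + r - 1) / Real.exp 1 ≤ (h + r - 1) / (h + r) :=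
        div_le_div_of_nonneg_left (by linarith) (by linarith) hse
      have h4 : (h + r - 1) / (h + r) = 1 - (h + r)⁻¹ := by
        rw [sub_div, div_self (by linarith), one_div]
      linarith
    · have h1 : 1 ≤ Real.log (h + r) := by
        rw [Real.le_log_iff_exp_le (by linarith)]
        exact hse
      refine le_trans ?_ h1
      rw [div_le_one hE]
      linarith
  · have h1 : Real.log h ≤ Real.log (h + r) :=
      Real.log_le_log (hE.trans (not_le.mp hh)) (by linarith)
    have h2 : r / Real.exp 1 ≤ β / Real.exp 1 := by gcongr
    linarith

theorem exp_sum_logMajorant_le {ι : Type*} [DecidableEq ι] (s : Finset ι) {q : ι → ℝ}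
    (hq : ∀ j, 0 ≤ q j) {β : ℝ} (hβ : 1 ≤ β) (hs : 1 ≤ ∑ j ∈ s, q j)
    (h : ∑ j ∈ s, q j ≤ β ∨ ∃ j ∈ s, ∑ l ∈ s.erase j, q l ≤ β) :
    Real.exp (∑ j ∈ s, logMajorant (q j)) ≤ (∑ j ∈ s, q j) * Real.exp (β / Real.exp 1) := by
  rw [← Real.le_log_iff_exp_le (by positivity), Real.log_mul (by positivity) (Real.exp_ne_zero _),
    Real.log_exp]
  rcases h with h | ⟨j, hj, h⟩
  · have h1 : (∑ j ∈ s, q j) / Real.exp 1 ≤ β / Real.exp 1 := by gcongr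
    linarith [sum_logMajorant_le_div s q, Real.log_nonneg hs]
  · rw [← add_sum_erase s q hj] at hs ⊢
    rw [← add_sum_erase s (fun j => logMajorant (q j)) hj]
    have := logMajorant_add_div_le (sum_nonneg fun l _ => hq l) h hβ hs
    linarith [sum_logMajorant_le_div (s.erase j) q]

theorem sum_sum_bundle {n m : ℕ} (a : Fin m → Fin n) (f : Fin m → ℝ) :
    ∑ k, ∑ j ∈ bundle a k, f j = ∑ j, f j :=
  sum_fiberwise univ a f

theorem prod_spend_le_of_one_le {n m : ℕ} {q : Fin m → ℝ} (hq : ∀ j, 0 ≤ q j) {β : ℝ}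
    (hβ : 1 ≤ β) (a y : Fin m → Fin n) (hs : ∀ k, 1 ≤ spend q a k)
    (h : ∀ k, spend q a k ≤ β ∨ ∃ j ∈ bundle a k, ∑ l ∈ (bundle a k).erase j, q l ≤ β) :
    ∏ i, spend q y i ≤ ∏ i, (spend q a i * Real.exp (β / Real.exp 1)) :=
  calc ∏ i, spend q y i
      ≤ ∏ i, Real.exp (∑ j ∈ bundle y i, logMajorant (q j)) :=
        prod_le_prod (fun i _ => sum_nonneg fun j _ => hq j) fun i _ =>
          (le_exp_logMajorant (sum_nonneg fun j _ => hq j)).trans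
            (Real.exp_le_exp.mpr (logMajorant_sum_le _ hq))
    _ = ∏ i, Real.exp (∑ j ∈ bundle a i, logMajorant (q j)) := by
        rw [← Real.exp_sum, ← Real.exp_sum, sum_sum_bundle, sum_sum_bundle]
    _ ≤ ∏ i, (spend q a i * Real.exp (β / Real.exp 1)) :=
        prod_le_prod (fun i _ => (Real.exp_pos _).le) fun i _ =>
          exp_sum_logMajorant_le _ hq hβ (hs i) (h i)

theorem prod_spend_le {n m : ℕ} (hn : 0 < n) {p : Fin m → ℝ} (hp : ∀ j, 0 ≤ p j) {β : ℝ}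
    (hβ : 1 ≤ β) (a y : Fin m → Fin n) (hpos : ∀ k, 0 < spend p a k)
    (h : ∀ i k, spend p a k ≤ β * spend p a i ∨
      ∃ j ∈ bundle a k, ∑ l ∈ (bundle a k).erase j, p l ≤ β * spend p a i) :
    ∏ i, spend p y i ≤ ∏ i, (spend p a i * Real.exp (β / Real.exp 1)) := by
  have : Nonempty (Fin n) := ⟨⟨0, hn⟩⟩
  obtain ⟨i₀, hi₀⟩ := Finite.exists_min (spend p a)
  set S := spend p a i₀ with hS
  have hS0 : 0 < S := hpos i₀
  have hscale (b : Fin m → Fin n) (k : Fin n) : spend (fun j => p j / S) b k = spend p b k / S :=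
    (sum_div ..).symm
  have key := prod_spend_le_of_one_le (q := fun j => p j / S) (fun j => div_nonneg (hp j) hS0.le)
    hβ a y (fun k => by rw [hscale, one_le_div hS0]; exact hi₀ k) (fun k => by
      rw [hscale, div_le_iff₀ hS0]
      refine (h i₀ k).imp id ?_
      rintro ⟨j, hj, hle⟩
      refine ⟨j, hj, ?_⟩
      rwa [← sum_div, div_le_iff₀ hS0])
  simp only [hscale, div_mul_eq_mul_div, prod_div_distrib] at key
  exact (div_le_div_iff_of_pos_right (prod_pos fun _ _ => hS0)).mp key

/-- If the smallest spending is zero, there are fewer goods than agents. -/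
theorem lt_of_spend_eq_zero {n m : ℕ} {p : Fin m → ℝ} (hp : ∀ j, 0 < p j) {β : ℝ}
    (a : Fin m → Fin n) {i : Fin n} (hi : spend p a i = 0)
    (h : ∀ k, spend p a k ≤ β * spend p a i ∨
      ∃ j ∈ bundle a k, ∑ l ∈ (bundle a k).erase j, p l ≤ β * spend p a i) :
    m < n := by
  simp only [hi, mul_zero] at h
  have hempty {s : Finset (Fin m)} (hs : ∑ j ∈ s, p j ≤ 0) : s = ∅ := by
    by_contra hne
    exact hs.not_gt (sum_pos (fun j _ => hp j) (nonempty_iff_ne_empty.mpr hne))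
  have hcard (k : Fin n) : (bundle a k).card ≤ 1 := by
    rcases h k with hk | ⟨j, hj, hk⟩
    · simp [hempty hk]
    · have := card_erase_add_one hj
      rw [hempty hk] at this
      simpa using this.ge
  have hinj : Function.Injective a := fun j l hjl =>
    card_le_one.mp (hcard (a j)) j (by simp [bundle]) l (by simp [bundle, hjl])
  have hnot : i ∉ Set.range a := by
    rintro ⟨j, rfl⟩
    have hj : j ∈ bundle a (a j) := by simp [bundle]
    rw [hempty hi.le] at hj
    simp at hj
  simpa using Fintype.card_lt_of_injective_of_notMem a hinj hnot

theorem NSW_nonneg {n m : ℕ} {v : Fin n → Fin m → ℝ} (hv : ∀ i j, 0 ≤ v i j)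
    (a : Fin m → Fin n) : 0 ≤ NSW v a :=
  Real.rpow_nonneg (prod_nonneg fun i _ => sum_nonneg fun j _ => hv i j) _

theorem NSW_eq_zero_of_lt {n m : ℕ} (hmn : m < n) (v : Fin n → Fin m → ℝ)
    (y : Fin m → Fin n) : NSW v y = 0 := by
  have hns : ¬ Function.Surjective y := fun hs =>
    hmn.not_ge (by simpa using Fintype.card_le_of_surjective y hs)
  simp only [Function.Surjective, not_forall, not_exists] at hns
  obtain ⟨i, hi⟩ := hns
  have hb : bundle y i = ∅ := filter_eq_empty_iff.mpr fun j _ => hi j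
  have h0 : ∏ i, ∑ j ∈ bundle y i, v i j = 0 := prod_eq_zero (mem_univ i) (by simp [hb])
  rw [NSW, h0, Real.zero_rpow (inv_ne_zero (by norm_cast; omega))]

theorem prod_value_le {n m : ℕ} {v : Fin n → Fin m → ℝ} (hv : ∀ i j, 0 ≤ v i j)
    {p : Fin m → ℝ} (hp : ∀ j, 0 < p j) (a y : Fin m → Fin n)
    (hMBB : ∀ i, ∀ j ∈ bundle a i, ∀ l, v i l / p l ≤ v i j / p j)
    (hpos : ∀ k, 0 < spend p a k) {c : ℝ}
    (h : ∏ i, spend p y i ≤ ∏ i, (spend p a i * c)) :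
    ∏ i, ∑ j ∈ bundle y i, v i j ≤ c ^ n * ∏ i, ∑ j ∈ bundle a i, v i j := by
  have hne (i : Fin n) : (bundle a i).Nonempty := by
    by_contra hne
    have := hpos i
    simp [spend, not_nonempty_iff_eq_empty.mp hne] at this
  choose g hg using hne
  have hle (i l) : v i l ≤ v i (g i) / p (g i) * p l :=
    (div_le_iff₀ (hp l)).mp (hMBB i _ (hg i) l)
  have hval (i) : ∑ j ∈ bundle a i, v i j = v i (g i) / p (g i) * spend p a i := by
    rw [spend, mul_sum]
    refine sum_congr rfl fun j hj => (hle i j).antisymm ?_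
    exact (le_div_iff₀ (hp j)).mp (hMBB i j hj (g i))
  calc ∏ i, ∑ j ∈ bundle y i, v i j
      ≤ ∏ i, (v i (g i) / p (g i) * spend p y i) :=
        prod_le_prod (fun i _ => sum_nonneg fun j _ => hv i j) fun i _ => by
          rw [spend, mul_sum]
          exact sum_le_sum fun l _ => hle i l
    _ ≤ (∏ i, v i (g i) / p (g i)) * ∏ i, (spend p a i * c) := by
        rw [prod_mul_distrib]
        exact mul_le_mul_of_nonneg_left h
          (prod_nonneg fun i _ => div_nonneg (hv _ _) (hp _).le)
    _ = c ^ n * ∏ i, ∑ j ∈ bundle a i, v i j := by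
        simp only [hval, prod_mul_distrib, prod_const, card_univ, Fintype.card_fin]
        ring

/-- If the bundle of each agent consists of maximum bang-per-buck goods under positive
prices `p` and the allocation is ε-pEF1 with respect to `p` (with `0 ≤ ε ≤ 1`), then the
allocation provides an `e^{(1+ε)/e}`-approximation to the maximum Nash social welfare. -/
theorem mbb_pEF1_nsw_approx (n m : ℕ) (hn : 0 < n)
    (v : Fin n → Fin m → ℝ) (hv : ∀ i j, 0 ≤ v i j)
    (hagent : ∀ i : Fin n, ∃ j : Fin m, 0 < v i j)
    (p : Fin m → ℝ) (hp : ∀ j, 0 < p j)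
    (ε : ℝ) (hε0 : 0 ≤ ε) (hε1 : ε ≤ 1)
    (a : Fin m → Fin n)
    (hMBB : ∀ i : Fin n, ∀ j ∈ bundle a i, ∀ l : Fin m, v i l / p l ≤ v i j / p j)
    (hpEF1 : ∀ i k : Fin n,
      spend p a k ≤ (1 + ε) * spend p a i ∨
        ∃ j ∈ bundle a k, (∑ j' ∈ (bundle a k).erase j, p j') ≤ (1 + ε) * spend p a i)
    (xstar : Fin m → Fin n) (hopt : ∀ b : Fin m → Fin n, NSW v b ≤ NSW v xstar) :
    Real.exp (-(1 + ε) / Real.exp 1) * NSW v xstar ≤ NSW v a := by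
  have hpos_or : (∃ i, spend p a i = 0) ∨ ∀ i, 0 < spend p a i := by
    by_contra! hcon
    obtain ⟨i, hi⟩ := hcon.2
    exact hcon.1 i (hi.antisymm (sum_nonneg fun j _ => (hp j).le))
  rcases hpos_or with ⟨i, hi⟩ | hpos
  · rw [NSW_eq_zero_of_lt (lt_of_spend_eq_zero hp a hi (hpEF1 i)), mul_zero]
    exact NSW_nonneg hv a
  have hprod := prod_value_le hv hp a xstar hMBB hpos
    (prod_spend_le hn (fun j => (hp j).le) (by linarith) a xstar hpos hpEF1)
  have hnonneg (b : Fin m → Fin n) : 0 ≤ ∏ i, ∑ j ∈ bundle b i, v i j :=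
    prod_nonneg fun i _ => sum_nonneg fun j _ => hv i j
  rw [neg_div, Real.exp_neg, inv_mul_le_iff₀ (Real.exp_pos _)]
  calc NSW v xstar
      ≤ (Real.exp ((1 + ε) / Real.exp 1) ^ n * ∏ i, ∑ j ∈ bundle a i, v i j) ^ ((n : ℝ)⁻¹) :=
        Real.rpow_le_rpow (hnonneg _) hprod (by positivity)
    _ = Real.exp ((1 + ε) / Real.exp 1) * NSW v a := by
        rw [Real.mul_rpow (by positivity) (hnonneg a),
          Real.pow_rpow_inv_natCast (Real.exp_pos _).le hn.ne', NSW]
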